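/- There do not exist an open interval I ⊆ ℝ, smooth functions x, y, r, c : I → ℝ with r > 0 on I, and a point τ₀ ∈ I with c(τ₀) ≠ 0, such that on I: x'' = 0, y'' = 0, r'' = r + c·r², c'' = c, and x'² + y'² + r'² = r². -/

import Mathlib

open Set

/-- Exclusion of Case (IV): `a ≡ b ≡ 0` (so `x'' = y'' = 0`) and `c ≠ 0`
at some point is impossible. -/
theorem case_IV_cannot_occur :
    ¬ ∃ (lo hi : ℝ) (x y r c : ℝ → ℝ) (τ₀ : ℝ),
      ContDiffOn ℝ (⊤ : ℕ∞) x (Ioo lo hi) ∧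
      ContDiffOn ℝ (⊤ : ℕ∞) y (Ioo lo hi) ∧
      ContDiffOn ℝ (⊤ : ℕ∞) r (Ioo lo hi) ∧
      ContDiffOn ℝ (⊤ : ℕ∞) c (Ioo lo hi) ∧
      (∀ τ ∈ Ioo lo hi, 0 < r τ) ∧
      τ₀ ∈ Ioo lo hi ∧ c τ₀ ≠ 0 ∧
      (∀ τ ∈ Ioo lo hi, deriv (deriv x) τ = 0) ∧
      (∀ τ ∈ Ioo lo hi, deriv (deriv y) τ = 0) ∧
      (∀ τ ∈ Ioo lo hi, deriv (deriv r) τ = r τ + c τ * r τ ^ 2) ∧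
      (∀ τ ∈ Ioo lo hi, deriv (deriv c) τ = c τ) ∧
      (∀ τ ∈ Ioo lo hi,
        deriv x τ ^ 2 + deriv y τ ^ 2 + deriv r τ ^ 2 = r τ ^ 2) := by
  rintro ⟨lo, hi, x, y, r, c, τ₀, hx, hy, hr, hc, hpos, hτ, hc0, hx2, hy2, hr2, hc2, harc⟩
  have hd : ∀ f : ℝ → ℝ, ContDiffOn ℝ (⊤ : ℕ∞) f (Ioo lo hi) → ∀ t ∈ Ioo lo hi,
      DifferentiableAt ℝ f t ∧ DifferentiableAt ℝ (deriv f) t := by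
    intro f hf t ht
    have hn := isOpen_Ioo.mem_nhds ht
    refine ⟨(hf.differentiableOn (by simp)).differentiableAt hn, ?_⟩
    have h1 : ContDiffOn ℝ 1 (deriv f) (Ioo lo hi) :=
      hf.deriv_of_isOpen isOpen_Ioo (by norm_cast)
    exact (h1.differentiableOn (by simp)).differentiableAt hn
  have hI : ∀ᶠ t in nhds τ₀, t ∈ Ioo lo hi := isOpen_Ioo.mem_nhds hτ
  have key : ∀ t ∈ Ioo lo hi, deriv r t * c t = 0 := by
    intro t ht
    have dx := (hd x hx t ht).2.hasDerivAt.pow 2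
    have dy := (hd y hy t ht).2.hasDerivAt.pow 2
    have dr := (hd r hr t ht).2.hasDerivAt.pow 2
    have d0 := (hd r hr t ht).1.hasDerivAt.pow 2
    have e : (deriv x ^ 2 + deriv y ^ 2 + deriv r ^ 2) =ᶠ[nhds t] r ^ 2 := by
      filter_upwards [isOpen_Ioo.mem_nhds ht] with s hs
      simpa using harc s hs
    have h := (((dx.add dy).add dr).congr_of_eventuallyEq e.symm).unique d0
    rw [hx2 t ht, hy2 t ht, hr2 t ht] at h
    have hp := hpos t ht
    have h2 : r t ^ 2 * (deriv r t * c t) = 0 := by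
      norm_num at h
      linear_combination h / 2
    exact (mul_eq_zero.mp h2).resolve_left (by positivity)
  have hcne : ∀ᶠ t in nhds τ₀, c t ≠ 0 :=
    (hd c hc τ₀ hτ).1.continuousAt.eventually_ne hc0
  have hr1 : ∀ᶠ t in nhds τ₀, deriv r t = 0 := by
    filter_upwards [hI, hcne] with t ht h
    exact (mul_eq_zero.mp (key t ht)).resolve_right h
  have hone : ∀ᶠ t in nhds τ₀, c t * r t = -1 := by
    filter_upwards [hI, hr1.eventually_nhds] with t ht h
    have h0 : deriv (deriv r) t = 0 := by
      have : deriv r =ᶠ[nhds t] fun _ => (0 : ℝ) := h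
      rw [this.deriv_eq]; simp
    have hp := hpos t ht
    rw [hr2 t ht] at h0
    have : r t * (c t * r t + 1) = 0 := by linear_combination h0
    have := (mul_eq_zero.mp this).resolve_left hp.ne'
    linarith
  have hc1 : ∀ᶠ t in nhds τ₀, deriv c t = 0 := by
    filter_upwards [hI, hr1, hone.eventually_nhds] with t ht h1 h
    have e : (c * r) =ᶠ[nhds t] fun _ => (-1 : ℝ) := h
    have d := ((hd c hc t ht).1.hasDerivAt.mul (hd r hr t ht).1.hasDerivAt).unique
      ((hasDerivAt_const t (-1 : ℝ)).congr_of_eventuallyEq e)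
    rw [h1] at d
    have hp := hpos t ht
    have d2 : deriv c t * r t = 0 := by linear_combination d
    exact (mul_eq_zero.mp d2).resolve_right hp.ne'
  apply hc0
  rw [← hc2 τ₀ hτ]
  have : deriv c =ᶠ[nhds τ₀] fun _ => (0 : ℝ) := hc1
  rw [this.deriv_eq]; simp
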